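/- arXiv:1801.07793 — 2 statements merged into one kernel-verified Lean document; each statement's English description precedes it below -/
import Mathlib

section
/- Let n ≥ 2, let a^1, …, a^K be non-strict incomplete rankings of n objects, and let r and s be any two complete rankings of the n objects. Then Σ_{k=1}^K τ_x(r, a^k) ≥ Σ_{k=1}^K τ_x(s, a^k) if and only if Σ_{k=1}^K d_{P-KS}(r, a^k) ≤ Σ_{k=1}^K d_{P-KS}(s, a^k). Consequently, the ranking aggregation problems of maximizing cumulative τ_x correlation and of minimizing cumulative d_{P-KS} distance over the space of complete rankings have identical optimal solution sets. -/
open Finset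

/-- A non-strict incomplete ranking of `n` objects: object `i` is ranked iff `a i ≠ none`. -/
abbrev Ranking (n : ℕ) := Fin n → Option ℕ

/-- The set of objects ranked by `a`. -/
def ranked {n : ℕ} (a : Ranking n) : Finset (Fin n) :=
  Finset.univ.filter fun i => (a i).isSome

/-- The ranking-matrix of `a`. -/
def rmat {n : ℕ} (a : Ranking n) (i j : Fin n) : ℤ :=
  if i = j then 0
  else
    match a i, a j with
    | some x, some y => if x ≤ y then 1 else -1
    | _, _ => 0

/-- `n̄(a,b)`: the number of objects ranked by both `a` and `b`. -/
def nbar {n : ℕ} (a b : Ranking n) : ℕ := (ranked a ∩ ranked b).card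

/-- The scaled Kendall tau-extended correlation coefficient `τ̂ₓ(a,b)`. -/
def tauHat {n : ℕ} (a b : Ranking n) : ℚ :=
  (∑ i : Fin n, ∑ j : Fin n, ((rmat a i j * rmat b i j : ℤ) : ℚ)) /
    ((nbar a b : ℚ) * ((nbar a b : ℚ) - 1))

/-- The Kendall tau-extended correlation coefficient `τₓ(a,b)` (extended ranking-matrix). -/
def tauX {n : ℕ} (a b : Ranking n) : ℚ :=
  (∑ i : Fin n, ∑ j : Fin n, ((rmat a i j * rmat b i j : ℤ) : ℚ)) /
    ((n : ℚ) * ((n : ℚ) - 1))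

/-- The projected Kemeny–Snell distance (minimum distance unit 1/2). -/
def dPKS {n : ℕ} (a b : Ranking n) : ℚ :=
  (1/4) * ∑ i ∈ ranked a ∩ ranked b, ∑ j ∈ ranked a ∩ ranked b,
    ((|(((a i).getD 0 : ℤ) - ((a j).getD 0 : ℤ)).sign -
       (((b i).getD 0 : ℤ) - ((b j).getD 0 : ℤ)).sign| : ℤ) : ℚ)

/-- The normalized projected Kemeny–Snell distance. -/
def dNPKS {n : ℕ} (a b : Ranking n) : ℚ :=
  if 2 ≤ nbar a b then
    dPKS a b / ((nbar a b : ℚ) * ((nbar a b : ℚ) - 1) / 2)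
  else 0

/-- The projection of `a` onto the subset `S` of objects. -/
def proj {n : ℕ} (a : Ranking n) (S : Finset (Fin n)) : Ranking n :=
  fun i => if i ∈ S then a i else none

theorem mem_ranked {n : ℕ} {a : Ranking n} {i : Fin n} : i ∈ ranked a ↔ ∃ x, a i = some x := by
  simp [ranked, Option.isSome_iff_exists]

theorem rmat_eq_zero_of_left {n : ℕ} {a : Ranking n} {i : Fin n} (hi : i ∉ ranked a)
    (j : Fin n) : rmat a i j = 0 := by
  have : a i = none := by simpa [ranked] using hi
  simp [rmat, this]

theorem rmat_eq_zero_of_right {n : ℕ} {a : Ranking n} {j : Fin n} (hj : j ∉ ranked a)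
    (i : Fin n) : rmat a i j = 0 := by
  have : a j = none := by simpa [ranked] using hj
  simp [rmat, this]

/-- The contribution of an unordered pair to the ranking-matrix product, in terms of signs. -/
theorem rmat_mul_add_rmat_mul_swap {n : ℕ} {a b : Ranking n} {i j : Fin n}
    (hi : i ∈ ranked a ∩ ranked b) (hj : j ∈ ranked a ∩ ranked b) :
    rmat a i j * rmat b i j + rmat a j i * rmat b j i =
      (if i = j then 0 else 2) -
        2 * |(((a i).getD 0 : ℤ) - ((a j).getD 0 : ℤ)).sign -
          (((b i).getD 0 : ℤ) - ((b j).getD 0 : ℤ)).sign| := by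
  rw [mem_inter, mem_ranked, mem_ranked] at hi hj
  obtain ⟨⟨x, hx⟩, ⟨y, hy⟩⟩ := hi
  obtain ⟨⟨z, hz⟩, ⟨w, hw⟩⟩ := hj
  by_cases hij : i = j
  · subst hij
    simp [rmat]
  · have sign_cases (u v : ℕ) : u < v ∧ ((u : ℤ) - v).sign = -1 ∨
        u = v ∧ ((u : ℤ) - v).sign = 0 ∨ v < u ∧ ((u : ℤ) - v).sign = 1 := by
      rcases lt_trichotomy u v with h | h | h
      · exact .inl ⟨h, Int.sign_eq_neg_one_of_neg (by omega)⟩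
      · exact .inr (.inl ⟨h, by simp [h]⟩)
      · exact .inr (.inr ⟨h, Int.sign_eq_one_of_pos (by omega)⟩)
    simp only [rmat, hx, hy, hz, hw, hij, Ne.symm hij, if_false, Option.getD_some]
    rcases sign_cases x z with ⟨h, e⟩ | ⟨h, e⟩ | ⟨h, e⟩ <;>
    rcases sign_cases y w with ⟨h', e'⟩ | ⟨h', e'⟩ | ⟨h', e'⟩ <;>
    rw [e, e'] <;> split_ifs <;> first | omega | rfl

theorem sum_rmat_mul_eq_sum_inter {n : ℕ} (a b : Ranking n) :
    ∑ i, ∑ j, rmat a i j * rmat b i j =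
      ∑ i ∈ ranked a ∩ ranked b, ∑ j ∈ ranked a ∩ ranked b, rmat a i j * rmat b i j := by
  have hz (i j : Fin n) (h : i ∉ ranked a ∩ ranked b ∨ j ∉ ranked a ∩ ranked b) :
      rmat a i j * rmat b i j = 0 := by
    simp only [mem_inter, not_and_or] at h
    rcases h with (h | h) | (h | h)
    · simp [rmat_eq_zero_of_left h]
    · simp [rmat_eq_zero_of_left h]
    · simp [rmat_eq_zero_of_right h]
    · simp [rmat_eq_zero_of_right h]
  rw [← sum_subset (subset_univ (ranked a ∩ ranked b))
    fun i _ hi => sum_eq_zero fun j _ => hz i j (.inl hi)]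
  exact sum_congr rfl fun i _ =>
    (sum_subset (subset_univ _) fun j _ hj => hz i j (.inr hj)).symm

/-- The ranking-matrix product is an affine function of the projected Kemeny–Snell distance. -/
theorem sum_rmat_mul_eq {n : ℕ} (a b : Ranking n) :
    ((∑ i, ∑ j, rmat a i j * rmat b i j : ℤ) : ℚ) =
      (nbar a b : ℚ) * ((nbar a b : ℚ) - 1) - 4 * dPKS a b := by
  have hpair : 2 * ∑ i, ∑ j, rmat a i j * rmat b i j =
      ∑ i ∈ ranked a ∩ ranked b, ∑ j ∈ ranked a ∩ ranked b,
        ((if i = j then 0 else 2) -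
          2 * |(((a i).getD 0 : ℤ) - ((a j).getD 0 : ℤ)).sign -
            (((b i).getD 0 : ℤ) - ((b j).getD 0 : ℤ)).sign|) := by
    rw [sum_rmat_mul_eq_sum_inter, two_mul]
    nth_rewrite 2 [sum_comm]
    simp only [← sum_add_distrib]
    exact sum_congr rfl fun i hi => sum_congr rfl fun j hj => rmat_mul_add_rmat_mul_swap hi hj
  have hcount : ∑ i ∈ ranked a ∩ ranked b, ∑ j ∈ ranked a ∩ ranked b,
      (if i = j then (0 : ℤ) else 2) = 2 * ((nbar a b : ℤ) * ((nbar a b : ℤ) - 1)) := by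
    have hrow : ∀ i ∈ ranked a ∩ ranked b, ∑ j ∈ ranked a ∩ ranked b,
        (if i = j then (0 : ℤ) else 2) = 2 * ((nbar a b : ℤ) - 1) := by
      intro i hi
      have hite (j : Fin n) : (if i = j then (0 : ℤ) else 2) = 2 - if i = j then 2 else 0 := by
        split_ifs <;> rfl
      simp only [hite, sum_sub_distrib, sum_ite_eq, if_pos hi, sum_const, nsmul_eq_mul, nbar]
      ring
    rw [sum_congr rfl hrow, sum_const, nsmul_eq_mul, nbar]
    ring
  simp only [sum_sub_distrib, hcount, ← mul_sum] at hpair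
  have hhalf := mul_left_cancel₀ two_ne_zero (hpair.trans (mul_sub _ _ _).symm)
  rw [hhalf, dPKS]
  push_cast
  ring

theorem tauX_eq {n : ℕ} (a b : Ranking n) :
    tauX a b = ((nbar a b : ℚ) * ((nbar a b : ℚ) - 1) - 4 * dPKS a b) /
      ((n : ℚ) * ((n : ℚ) - 1)) := by
  rw [← sum_rmat_mul_eq, tauX]
  push_cast
  rfl

theorem nbar_of_complete {n : ℕ} {r : Ranking n} (hr : ranked r = univ) (a : Ranking n) :
    nbar r a = (ranked a).card := by
  simp [nbar, hr]

theorem sum_tauX_le_iff_sum_dPKS_le {n K : ℕ} (hn : 2 ≤ n) (a : Fin K → Ranking n)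
    {r s : Ranking n} (hr : ranked r = univ) (hs : ranked s = univ) :
    ∑ k, tauX s (a k) ≤ ∑ k, tauX r (a k) ↔ ∑ k, dPKS r (a k) ≤ ∑ k, dPKS s (a k) := by
  have hn' : (2 : ℚ) ≤ n := by exact_mod_cast hn
  have hpos : (0 : ℚ) < (n : ℚ) * ((n : ℚ) - 1) := mul_pos (by linarith) (by linarith)
  simp only [tauX_eq, nbar_of_complete hr, nbar_of_complete hs, ← sum_div, sum_sub_distrib,
    ← mul_sum]
  rw [div_le_div_iff_of_pos_right hpos]
  constructor <;> intro h <;> linarith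

/-- Corollary 1 (second part): the NIRA problems typified by τₓ and d_P-KS are equivalent. -/
theorem tauX_dPKS_aggregation_equiv (n K : ℕ) (hn : 2 ≤ n) (a : Fin K → Ranking n)
    (r s : Ranking n) (hr : ranked r = Finset.univ) (hs : ranked s = Finset.univ) :
    ((∑ k, tauX s (a k) ≤ ∑ k, tauX r (a k)) ↔
      (∑ k, dPKS r (a k) ≤ ∑ k, dPKS s (a k))) ∧
    ({r' : Ranking n | ranked r' = Finset.univ ∧
        ∀ s' : Ranking n, ranked s' = Finset.univ →
          ∑ k, tauX s' (a k) ≤ ∑ k, tauX r' (a k)} =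
      {r' : Ranking n | ranked r' = Finset.univ ∧
        ∀ s' : Ranking n, ranked s' = Finset.univ →
          ∑ k, dPKS r' (a k) ≤ ∑ k, dPKS s' (a k)}) := by
  refine ⟨sum_tauX_le_iff_sum_dPKS_le hn a hr hs, Set.ext fun r' => and_congr_right fun hr' => ?_⟩
  exact forall₂_congr fun s' hs' => sum_tauX_le_iff_sum_dPKS_le hn a hr' hs'
end

section
/- (Scaling axiom for τ̂_x: characterization of minimal correlation.) For any two non-strict incomplete rankings a, b of n objects with n̄(a,b) ≥ 2, τ̂_x(a, b) = −1 if and only if M(b)_{ij} = −M(a)_{ij} for all distinct i, j ∈ V_a ∩ V_b; in this case both projections onto V_a ∩ V_b are linear orderings (neither a nor b ties any two distinct objects of V_a ∩ V_b) and the projection of b is the reverse of the projection of a. -/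
open Finset

lemma rmat_eq_zero_of_notMem_ranked {n : ℕ} {a : Ranking n} {i j : Fin n}
    (h : ¬(i ∈ ranked a ∧ j ∈ ranked a)) : rmat a i j = 0 := by
  unfold rmat
  cases hi : a i <;> cases hj : a j <;> simp_all [ranked]

lemma rmat_eq_one_or_neg_one {n : ℕ} {a : Ranking n} {i j : Fin n}
    (hi : i ∈ ranked a) (hj : j ∈ ranked a) (hij : i ≠ j) :
    rmat a i j = 1 ∨ rmat a i j = -1 := by
  unfold rmat
  cases hai : a i <;> cases haj : a j <;> simp_all [ranked]
  exact le_or_gt _ _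

lemma rmat_eq_one_or_rmat_swap_eq_one {n : ℕ} {a : Ranking n} {i j : Fin n}
    (hi : i ∈ ranked a) (hj : j ∈ ranked a) (hij : i ≠ j) :
    rmat a i j = 1 ∨ rmat a j i = 1 := by
  have hji := hij.symm
  unfold rmat
  cases hai : a i <;> cases haj : a j <;> simp_all [ranked]
  exact le_total _ _

lemma sum_rmat_mul_rmat {n : ℕ} (a b : Ranking n) :
    ∑ i, ∑ j, rmat a i j * rmat b i j =
      ∑ p ∈ (ranked a ∩ ranked b).offDiag, rmat a p.1 p.2 * rmat b p.1 p.2 := by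
  rw [← Fintype.sum_prod_type' (fun i j => rmat a i j * rmat b i j)]
  symm
  refine Finset.sum_subset (Finset.subset_univ _) fun p _ hp => ?_
  by_cases hij : p.1 = p.2
  · simp [rmat, hij]
  by_cases ha : p.1 ∈ ranked a ∧ p.2 ∈ ranked a
  · have hb : ¬(p.1 ∈ ranked b ∧ p.2 ∈ ranked b) := fun hb =>
      hp (by simp [Finset.mem_offDiag, ha.1, ha.2, hb.1, hb.2, hij])
    rw [rmat_eq_zero_of_notMem_ranked hb, mul_zero]
  · rw [rmat_eq_zero_of_notMem_ranked ha, zero_mul]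

lemma tauHat_eq_neg_one_iff_sum_eq_zero {n : ℕ} {a b : Ranking n} (h : 2 ≤ nbar a b) :
    tauHat a b = -1 ↔
      ∑ p ∈ (ranked a ∩ ranked b).offDiag, (1 + rmat a p.1 p.2 * rmat b p.1 p.2) = 0 := by
  have hcard : ((ranked a ∩ ranked b).offDiag.card : ℤ) = nbar a b * (nbar a b - 1) := by
    rw [Finset.offDiag_card, Nat.cast_sub (Nat.le_mul_self _), nbar]
    push_cast
    ring
  have hq : (2 : ℚ) ≤ nbar a b := by exact_mod_cast h
  have hpos : (0 : ℚ) < (nbar a b : ℚ) * ((nbar a b : ℚ) - 1) :=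
    mul_pos (by linarith) (by linarith)
  rw [Finset.sum_add_distrib, Finset.sum_const, nsmul_one, hcard, ← sum_rmat_mul_rmat, tauHat,
    div_eq_iff hpos.ne', ← @Int.cast_inj ℚ]
  push_cast
  constructor <;> intro h <;> linarith

/-- Axiom 6 (Scaling), minimal value: τ̂ₓ(a,b) = -1 iff on the commonly ranked objects the
ranking-matrix of `b` is the negation of that of `a` (i.e., the projection of `b` is the
reverse of the projection of `a`); in this case neither projection contains ties, i.e.,
both are linear orderings. -/
theorem tauHat_eq_neg_one_iff (n : ℕ) (a b : Ranking n) (h : 2 ≤ nbar a b) :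
    (tauHat a b = -1 ↔
      ∀ i j, i ∈ ranked a ∩ ranked b → j ∈ ranked a ∩ ranked b → i ≠ j →
        rmat b i j = - rmat a i j) ∧
    (tauHat a b = -1 →
      ∀ i j, i ∈ ranked a ∩ ranked b → j ∈ ranked a ∩ ranked b → i ≠ j →
        ¬(rmat a i j = 1 ∧ rmat a j i = 1) ∧ ¬(rmat b i j = 1 ∧ rmat b j i = 1)) := by
  have hiff : tauHat a b = -1 ↔
      ∀ i j, i ∈ ranked a ∩ ranked b → j ∈ ranked a ∩ ranked b → i ≠ j →
        rmat b i j = - rmat a i j := by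
    rw [tauHat_eq_neg_one_iff_sum_eq_zero h, Finset.sum_eq_zero_iff_of_nonneg]
    · simp only [Prod.forall, Finset.mem_offDiag, Finset.mem_inter]
      refine forall₂_congr fun i j => ⟨fun H hi hj hij => ?_, fun H hp => ?_⟩
      · have := H ⟨hi, hj, hij⟩
        rcases rmat_eq_one_or_neg_one hi.1 hj.1 hij with e | e <;> rw [e] at this ⊢ <;> linarith
      · obtain ⟨hi, hj, hij⟩ := hp
        rw [H hi hj hij]
        rcases rmat_eq_one_or_neg_one hi.1 hj.1 hij with e | e <;> rw [e] <;> norm_num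
    · intro p hp
      simp only [Finset.mem_offDiag, Finset.mem_inter] at hp
      obtain ⟨hi, hj, hij⟩ := hp
      rcases rmat_eq_one_or_neg_one hi.1 hj.1 hij with e | e <;>
        rcases rmat_eq_one_or_neg_one hi.2 hj.2 hij with f | f <;> rw [e, f] <;> norm_num
  refine ⟨hiff, fun hτ i j hi hj hij => ?_⟩
  have h₁ := hiff.1 hτ i j hi hj hij
  have h₂ := hiff.1 hτ j i hj hi hij.symm
  rw [Finset.mem_inter] at hi hj
  have ha := rmat_eq_one_or_rmat_swap_eq_one hi.1 hj.1 hij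
  have hb := rmat_eq_one_or_rmat_swap_eq_one hi.2 hj.2 hij
  omega
end
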